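/- Let (u, b, p) be a smooth bounded solution of the stationary MHD/Hall–MHD system with parameter δ ∈ [0,1] on the slab ℝ²×𝕋. Then for every R > 2: ∫_{ℝ²×[0,1]} (|∇u|² + |∇b|²) φ_R dx = ∫_{O_R} (∂_r u · u + ∂_r b · b) dx − (1/2) ∫_{O_R} (|u|² + |b|²) u^r dx − ∫_{O_R} (p − p_R) u^r dx + ∫_{O_R} (u·b) b^r dx − δ ∫_{O_R} ((∇×b)×b)·((x'/|x'|, 0) × b) dx, where p_R = (1/|O_R|) ∫_{O_R} p dx and ∂_r f(x) = (x'/|x'|)·(∂₁f(x), ∂₂f(x)) denotes the radial derivative applied componentwise. -/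

import Mathlib

open MeasureTheory

noncomputable section

/-- Points of `ℝ³`. -/
abbrev V3 : Type := Fin 3 → ℝ

/-- Partial derivative `∂ᵢ f`. -/
def pd (i : Fin 3) (f : V3 → ℝ) (x : V3) : ℝ := fderiv ℝ f x (Pi.single i 1)

/-- Componentwise Laplacian. -/
def lap (f : V3 → ℝ) (x : V3) : ℝ := ∑ i, pd i (pd i f) x

/-- Cross product in `ℝ³`. -/
def cross3 (a c : V3) : V3 :=
  ![a 1 * c 2 - a 2 * c 1, a 2 * c 0 - a 0 * c 2, a 0 * c 1 - a 1 * c 0]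

/-- Curl of a vector field. -/
def curl (b : V3 → V3) (x : V3) : V3 :=
  ![pd 1 (fun y => b y 2) x - pd 2 (fun y => b y 1) x,
    pd 2 (fun y => b y 0) x - pd 0 (fun y => b y 2) x,
    pd 0 (fun y => b y 1) x - pd 1 (fun y => b y 0) x]

/-- Euclidean dot product in `ℝ³`. -/
def dot3 (a c : V3) : ℝ := ∑ i, a i * c i

/-- `|x'| = √(x₁² + x₂²)`. -/
def nr (x : V3) : ℝ := Real.sqrt ((x 0) ^ 2 + (x 1) ^ 2)

/-- The slab `ℝ² × [0,1]`. -/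
def slab : Set V3 := {x | 0 ≤ x 2 ∧ x 2 ≤ 1}

/-- The region `{|x'| ≤ R} × [0,1]`. -/
def cylSet (R : ℝ) : Set V3 := {x | (0 ≤ x 2 ∧ x 2 ≤ 1) ∧ nr x ≤ R}

/-- The annular region `O_R = {R-1 ≤ |x'| ≤ R} × [0,1]`. -/
def OR (R : ℝ) : Set V3 := {x | (0 ≤ x 2 ∧ x 2 ≤ 1) ∧ R - 1 ≤ nr x ∧ nr x ≤ R}

/-- The radial cut-off function `φ_R`. -/
def phiR (R : ℝ) (x : V3) : ℝ := min 1 (max 0 (R - nr x))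

/-- `|∇u|² = Σ_{i,j} |∂ᵢ uʲ|²`. -/
def gradSq (u : V3 → V3) (x : V3) : ℝ := ∑ i, ∑ j, (pd i (fun y => u y j) x) ^ 2

/-- The `L²` norm of a scalar function on a set. -/
def l2 (f : V3 → ℝ) (S : Set V3) : ℝ := Real.sqrt (∫ x in S, (f x) ^ 2)

/-- The radial component `u^r` as a function of `x`. -/
def ur (u : V3 → V3) (x : V3) : ℝ := (x 0 * u x 0 + x 1 * u x 1) / nr x

/-- The point with cylindrical coordinates `(r, θ, z)`. -/
def cylPt (r θ z : ℝ) : V3 := ![r * Real.cos θ, r * Real.sin θ, z]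

/-- The radial component `u^r` in cylindrical coordinates. -/
def compR (u : V3 → V3) (r θ z : ℝ) : ℝ :=
  Real.cos θ * u (cylPt r θ z) 0 + Real.sin θ * u (cylPt r θ z) 1

/-- The swirl component `u^θ` in cylindrical coordinates. -/
def compTheta (u : V3 → V3) (r θ z : ℝ) : ℝ :=
  -Real.sin θ * u (cylPt r θ z) 0 + Real.cos θ * u (cylPt r θ z) 1

/-- A cylindrical component is axisymmetric if it is independent of `θ`. -/
def AxiSym (f : ℝ → ℝ → ℝ → ℝ) : Prop := ∀ r θ₁ θ₂ z, f r θ₁ z = f r θ₂ z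

/-- `1`-periodicity in the `x₃` variable. -/
def PeriodicZ (u : V3 → V3) : Prop := ∀ x : V3, u ![x 0, x 1, x 2 + 1] = u x

/-- Divergence-free vector field. -/
def DivFree (u : V3 → V3) : Prop := ∀ x, ∑ i, pd i (fun y => u y i) x = 0

/-- Boundedness of a vector field. -/
def Bounded3 (u : V3 → V3) : Prop := ∃ M, ∀ x, ‖u x‖ ≤ M

/-- The stationary MHD (`δ = 0`) / Hall–MHD (`δ = 1`) system:
`(u·∇)u + ∇p − (b·∇)b − Δu = 0`,
`(u·∇)b − (b·∇)u − Δb = δ ∇×((∇×b)×b)`, `div u = div b = 0`. -/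
def IsMHD (δ : ℝ) (u b : V3 → V3) (p : V3 → ℝ) : Prop :=
  (∀ x i, (∑ j, u x j * pd j (fun y => u y i) x) + pd i p x
      - (∑ j, b x j * pd j (fun y => b y i) x) - lap (fun y => u y i) x = 0) ∧
  (∀ x i, (∑ j, u x j * pd j (fun y => b y i) x)
      - (∑ j, b x j * pd j (fun y => u y i) x) - lap (fun y => b y i) x
      = δ * curl (fun y => cross3 (curl b y) (b y)) x i) ∧
  DivFree u ∧ DivFree b

/-- Growth of the local Dirichlet integral: `∫_{{|x'|≤R}×[0,1]} |∇u|²+|∇b|² ≤ C R^α`. -/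
def DirichletGrowth (u b : V3 → V3) : Prop :=
  ∃ C > (0:ℝ), ∃ α > (0:ℝ), ∀ R > (1:ℝ),
    (∫ x in cylSet R, (gradSq u x + gradSq b x)) ≤ C * R ^ α

/-- Radial derivative `∂_r f = (x'/|x'|)·(∂₁f, ∂₂f)`. -/
def radD (f : V3 → ℝ) (x : V3) : ℝ := (x 0 / nr x) * pd 0 f x + (x 1 / nr x) * pd 1 f x

/-- The unit radial vector `(x'/|x'|, 0)`. -/
def er3 (x : V3) : V3 := ![x 0 / nr x, x 1 / nr x, 0]

/-- Squared Euclidean length of a vector of `ℝ³`. -/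
def sq3 (v : V3) : ℝ := ∑ i, (v i) ^ 2

open Function in
theorem integral_eq_zero_of_integral_line_eq_zero (i : Fin 3) (f : V3 → ℝ)
    (h : ∀ x, ∫ t, f (update x i t) = 0) : ∫ x, f x = 0 := by
  by_cases hf : Integrable f
  · have mp := (volume_preserving_piFinSuccAbove (fun _ : Fin 3 => ℝ) i).symm
    rw [← mp.integral_comp' f]
    have hint := (mp.integrable_comp_emb (MeasurableEquiv.measurableEmbedding _)).2 hf
    rw [show (volume : Measure (ℝ × (Fin 2 → ℝ))) = (volume : Measure ℝ).prod volume from rfl]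
      at hint ⊢
    refine (integral_prod_symm _ hint).trans ?_
    refine integral_eq_zero_of_ae (Filter.Eventually.of_forall fun y => ?_)
    have := h (i.insertNth 0 y)
    simp only [Fin.update_insertNth] at this
    exact this
  · exact integral_undef hf

theorem measurableSet_slab : MeasurableSet slab :=
  ((isClosed_le continuous_const (continuous_apply 2)).inter
    (isClosed_le (continuous_apply 2) continuous_const)).measurableSet

theorem mem_slab_update {i : Fin 3} (hi : i ≠ 2) (x : V3) (t : ℝ) :
    Function.update x i t ∈ slab ↔ x ∈ slab := by
  simp [slab, Function.update_of_ne hi.symm]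

open Function in
theorem setIntegral_slab_eq_zero_horizontal {i : Fin 3} (hi : i ≠ 2) (g : V3 → ℝ)
    (h : ∀ x, ∫ t, g (update x i t) = 0) : ∫ x in slab, g x = 0 := by
  rw [← integral_indicator measurableSet_slab]
  refine integral_eq_zero_of_integral_line_eq_zero i _ fun x => ?_
  by_cases hx : x ∈ slab
  · rw [← h x]
    congr 1
    ext t
    rw [Set.indicator_of_mem ((mem_slab_update hi x t).2 hx)]
  · rw [← integral_zero ℝ ℝ]
    congr 1
    ext t
    rw [Set.indicator_of_notMem (mt (mem_slab_update hi x t).1 hx)]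

open Function in
theorem setIntegral_slab_eq_zero_vertical (g : V3 → ℝ)
    (h : ∀ x, ∫ t in (0 : ℝ)..1, g (update x 2 t) = 0) : ∫ x in slab, g x = 0 := by
  rw [← integral_indicator measurableSet_slab]
  refine integral_eq_zero_of_integral_line_eq_zero 2 _ fun x => ?_
  rw [← h x, intervalIntegral.integral_of_le zero_le_one, ← integral_Icc_eq_integral_Ioc,
    ← integral_indicator measurableSet_Icc]
  refine integral_congr_ae (Filter.Eventually.of_forall fun t => ?_)
  simp [Set.indicator, slab]

theorem hasDerivAt_comp_update {f : V3 → ℝ} (i : Fin 3) (x : V3) (t : ℝ)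
    (hf : DifferentiableAt ℝ f (Function.update x i t)) :
    HasDerivAt (fun s => f (Function.update x i s)) (pd i f (Function.update x i t)) t :=
  hf.hasFDerivAt.comp_hasDerivAt t (hasDerivAt_update x i t)

theorem continuous_pd {f : V3 → ℝ} (hf : ContDiff ℝ 1 f) (i : Fin 3) : Continuous (pd i f) :=
  (hf.continuous_fderiv one_ne_zero).clm_apply continuous_const

theorem continuous_nr : Continuous nr := by unfold nr; fun_prop

theorem continuous_phiR (R : ℝ) : Continuous (phiR R) := by
  have := continuous_nr
  unfold phiR; fun_prop

theorem abs_le_nr {x : V3} {i : Fin 3} (hi : i ≠ 2) : |x i| ≤ nr x := by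
  apply Real.abs_le_sqrt
  fin_cases i
  · simp; positivity
  · simp; positivity
  · simp at hi


/-- Minus the radial derivative of the cut-off `phiR R`, divided by the radius. -/
def annulusWeight (R : ℝ) : V3 → ℝ :=
  {x | R - 1 ≤ nr x ∧ nr x ≤ R}.indicator fun x => (nr x)⁻¹

theorem annulusWeight_of_mem {R : ℝ} {x : V3} (h : R - 1 ≤ nr x ∧ nr x ≤ R) :
    annulusWeight R x = (nr x)⁻¹ := Set.indicator_of_mem (s := {x | R - 1 ≤ nr x ∧ nr x ≤ R}) h _

theorem annulusWeight_of_notMem {R : ℝ} {x : V3} (h : ¬ (R - 1 ≤ nr x ∧ nr x ≤ R)) :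
    annulusWeight R x = 0 := Set.indicator_of_notMem (s := {x | R - 1 ≤ nr x ∧ nr x ≤ R}) h _

theorem measurable_annulusWeight (R : ℝ) : Measurable (annulusWeight R) :=
  continuous_nr.measurable.inv.indicator
    ((isClosed_le continuous_const continuous_nr).inter
      (isClosed_le continuous_nr continuous_const)).measurableSet

theorem abs_annulusWeight_le {R : ℝ} (hR : 2 < R) (x : V3) : |annulusWeight R x| ≤ 1 := by
  by_cases h : R - 1 ≤ nr x ∧ nr x ≤ R
  · rw [annulusWeight_of_mem h, abs_of_nonneg (inv_nonneg.2 (by linarith [h.1]))]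
    exact inv_le_one_of_one_le₀ (by linarith [h.1])
  · simp [annulusWeight_of_notMem h]

theorem nr_update {i : Fin 3} (hi : i ≠ 2) (x : V3) :
    ∃ s : ℝ, ∀ t, nr (Function.update x i t) = Real.sqrt (t ^ 2 + s ^ 2) := by
  fin_cases i
  · exact ⟨x 1, fun t => by simp [nr]⟩
  · exact ⟨x 0, fun t => by simp [nr, add_comm]⟩
  · simp at hi

theorem countable_sphere_line (s a : ℝ) : {t : ℝ | Real.sqrt (t ^ 2 + s ^ 2) = a}.Countable := by
  refine Set.Finite.countable ((Set.toFinite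
    {Real.sqrt (a ^ 2 - s ^ 2), -Real.sqrt (a ^ 2 - s ^ 2)}).subset fun t ht => ?_)
  have ht : Real.sqrt (t ^ 2 + s ^ 2) = a := ht
  have h1 : a ^ 2 - s ^ 2 = t ^ 2 := by
    rw [← ht, Real.sq_sqrt (by positivity)]; ring
  rw [h1, Real.sqrt_sq_eq_abs]
  rcases abs_choice t with h | h <;> simp [h]

theorem hasDerivAt_phiR_update {R : ℝ} (hR : 2 < R) {i : Fin 3} (hi : i ≠ 2) (x : V3) (t : ℝ)
    (h1 : nr (Function.update x i t) ≠ R) (h2 : nr (Function.update x i t) ≠ R - 1) :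
    HasDerivAt (fun s => phiR R (Function.update x i s))
      (-t * annulusWeight R (Function.update x i t)) t := by
  obtain ⟨c, hc⟩ := nr_update hi x
  have hcont : Continuous fun s => nr (Function.update x i s) :=
    continuous_nr.comp (continuous_const.update i continuous_id)
  rcases lt_or_gt_of_ne h1 with h1 | h1
  · rcases lt_or_gt_of_ne h2 with h2 | h2
    · rw [annulusWeight_of_notMem fun h => by linarith [h.1], mul_zero]
      refine (hasDerivAt_const t (1 : ℝ)).congr_of_eventuallyEq ?_
      filter_upwards [hcont.continuousAt.eventually_lt continuousAt_const h2] with s hs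
      rw [phiR, max_eq_right (by linarith), min_eq_left (by linarith)]
    · rw [annulusWeight_of_mem ⟨h2.le, h1.le⟩]
      have hpos : 0 < t ^ 2 + c ^ 2 := by
        refine Real.sqrt_pos.1 ?_
        rw [← hc]; linarith
      have hd : HasDerivAt (fun s => R - Real.sqrt (s ^ 2 + c ^ 2))
          (-t * (nr (Function.update x i t))⁻¹) t := by
        refine ((((hasDerivAt_pow 2 t).add_const (c ^ 2)).sqrt hpos.ne').const_sub R).congr_deriv ?_
        rw [hc]
        simp
        field_simp
      refine hd.congr_of_eventuallyEq ?_
      filter_upwards [hcont.continuousAt.eventually_lt continuousAt_const h1,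
        continuousAt_const.eventually_lt hcont.continuousAt h2] with s hs hs'
      rw [phiR, max_eq_right (by linarith), min_eq_right (by linarith), hc]
  · rw [annulusWeight_of_notMem fun h => by linarith [h.2], mul_zero]
    refine (hasDerivAt_const t (0 : ℝ)).congr_of_eventuallyEq ?_
    filter_upwards [continuousAt_const.eventually_lt hcont.continuousAt h1] with s hs
    rw [phiR, max_eq_left (by linarith), min_eq_right (by linarith)]

theorem phiR_of_le_nr {R : ℝ} {x : V3} (h : R ≤ nr x) : phiR R x = 0 := by
  rw [phiR, max_eq_left (by linarith), min_eq_right (by linarith)]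

theorem phiR_of_nr_le {R : ℝ} {x : V3} (h : nr x ≤ R - 1) : phiR R x = 1 := by
  rw [phiR, max_eq_right (by linarith), min_eq_left (by linarith)]

open Function in
theorem setIntegral_slab_phiR_horizontal {R : ℝ} (hR : 2 < R) {i : Fin 3} (hi : i ≠ 2)
    {g : V3 → ℝ} (hg : ContDiff ℝ 1 g) :
    ∫ x in slab, (phiR R x * pd i g x - x i * annulusWeight R x * g x) = 0 := by
  refine setIntegral_slab_eq_zero_horizontal hi _ fun x => ?_
  have hupd : Continuous fun t : ℝ => update x i t := continuous_const.update i continuous_id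
  have hlarge : ∀ t : ℝ, R < |t| → R < nr (update x i t) := fun t ht =>
    ht.trans_le (by simpa using abs_le_nr (x := update x i t) hi)
  rw [← intervalIntegral.integral_eq_integral_of_support_subset (a := -(R + 1)) (b := R + 1)]
  · obtain ⟨c, hc⟩ := nr_update hi x
    have hint : IntervalIntegrable (fun t => phiR R (update x i t) * pd i g (update x i t)
        - update x i t i * annulusWeight R (update x i t) * g (update x i t)) volume
        (-(R + 1)) (R + 1) := by
      refine IntervalIntegrable.sub (Continuous.intervalIntegrable ?_ _ _) ?_
      · exact ((continuous_phiR R).comp hupd).mul ((continuous_pd hg i).comp hupd)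
      · have hw : IntervalIntegrable (fun t => annulusWeight R (update x i t)) volume
            (-(R + 1)) (R + 1) := by
          refine (intervalIntegrable_const (c := (1 : ℝ))).mono_fun
            ((measurable_annulusWeight R).comp hupd.measurable).aestronglyMeasurable
            (Filter.Eventually.of_forall fun t => ?_)
          simpa using abs_annulusWeight_le hR _
        have : Continuous fun t => update x i t i * g (update x i t) := by
          have := hg.continuous
          fun_prop
        refine (hw.mul_continuousOn this.continuousOn).congr fun t _ => ?_
        ring
    rw [integral_eq_of_hasDerivAt_off_countable
      (fun t => phiR R (update x i t) * g (update x i t)) _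
      ((countable_sphere_line c R).union (countable_sphere_line c (R - 1))) ?_ ?_ hint]
    · rw [phiR_of_le_nr (hlarge _ _).le, phiR_of_le_nr (hlarge _ _).le]
      · simp
      · rw [abs_neg, abs_of_pos] <;> linarith
      · rw [abs_of_pos] <;> linarith
    · exact (((continuous_phiR R).comp hupd).mul (hg.continuous.comp hupd)).continuousOn
    · rintro t ⟨-, ht⟩
      rw [Set.mem_union, not_or] at ht
      have hd := (hasDerivAt_phiR_update hR hi x t (by rw [hc]; exact ht.1)
        (by rw [hc]; exact ht.2)).mul
        (hasDerivAt_comp_update i x t (hg.differentiable one_ne_zero _))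
      refine hd.congr_deriv ?_
      simp
      ring
  · intro t ht
    by_contra hcon
    have : R < |t| := by
      by_contra hle
      have := abs_le.1 (not_lt.1 hle)
      exact hcon ⟨by linarith, by linarith⟩
    have := hlarge t this
    apply ht
    beta_reduce
    rw [phiR_of_le_nr this.le, annulusWeight_of_notMem fun h => by linarith [h.2]]
    simp

open Function in
theorem setIntegral_slab_phiR_vertical (R : ℝ) {g : V3 → ℝ} (hg : ContDiff ℝ 1 g)
    (hper : ∀ x, g (x + Pi.single 2 1) = g x) :
    ∫ x in slab, phiR R x * pd 2 g x = 0 := by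
  refine setIntegral_slab_eq_zero_vertical _ fun x => ?_
  have hupd : Continuous fun t : ℝ => update x 2 t := continuous_const.update 2 continuous_id
  have hphi : ∀ t, phiR R (update x 2 t) = phiR R x := fun t => by simp [phiR, nr]
  simp only [hphi, intervalIntegral.integral_const_mul]
  rw [intervalIntegral.integral_eq_sub_of_hasDerivAt
    (fun t _ => hasDerivAt_comp_update 2 x t (hg.differentiable one_ne_zero _))
    (((continuous_pd hg 2).comp hupd).intervalIntegrable _ _)]
  have : update x 2 (1 : ℝ) = update x 2 (0 : ℝ) + Pi.single 2 1 := by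
    ext j
    fin_cases j <;> simp
  rw [this, hper]
  simp

theorem isCompact_cylSet (R : ℝ) : IsCompact (cylSet R) := by
  refine (isCompact_Icc (a := ![-R, -R, 0]) (b := ![R, R, 1])).of_isClosed_subset ?_ ?_
  · exact ((isClosed_le continuous_const (continuous_apply 2)).inter
      (isClosed_le (continuous_apply 2) continuous_const)).inter
      (isClosed_le continuous_nr continuous_const)
  · rintro x ⟨⟨h0, h1⟩, h2⟩
    have h3 := abs_le.1 ((abs_le_nr (x := x) (i := 0) (by decide)).trans h2)
    have h4 := abs_le.1 ((abs_le_nr (x := x) (i := 1) (by decide)).trans h2)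
    constructor <;> intro j <;> fin_cases j <;> simp <;> linarith

theorem integrableOn_slab_of_cylSet {R : ℝ} {f : V3 → ℝ} (hf : IntegrableOn f (cylSet R))
    (h0 : ∀ x, R < nr x → f x = 0) : IntegrableOn f slab :=
  hf.of_forall_sdiff_eq_zero measurableSet_slab fun x hx =>
    h0 x (not_le.1 fun h => hx.2 ⟨hx.1, h⟩)

theorem integrableOn_slab_phiR_mul (R : ℝ) {f : V3 → ℝ} (hf : Continuous f) :
    IntegrableOn (fun x => phiR R x * f x) slab :=
  integrableOn_slab_of_cylSet
    (((continuous_phiR R).mul hf).continuousOn.integrableOn_compact (isCompact_cylSet R))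
    fun x hx => by rw [phiR_of_le_nr hx.le, zero_mul]

theorem integrableOn_slab_annulusWeight_mul {R : ℝ} (hR : 2 < R) {f : V3 → ℝ}
    (hf : Continuous f) : IntegrableOn (fun x => annulusWeight R x * f x) slab := by
  refine integrableOn_slab_of_cylSet (R := R) ?_ fun x hx => by
    rw [annulusWeight_of_notMem fun h => by linarith [h.2], zero_mul]
  exact (hf.continuousOn.integrableOn_compact (isCompact_cylSet R)).bdd_mul (c := 1)
    (measurable_annulusWeight R).aestronglyMeasurable
    (Filter.Eventually.of_forall fun x => abs_annulusWeight_le hR x)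

theorem setIntegral_slab_annulusWeight_mul (R : ℝ) (f : V3 → ℝ) :
    ∫ x in slab, annulusWeight R x * f x = ∫ x in OR R, f x / nr x := by
  have hs : MeasurableSet {x : V3 | R - 1 ≤ nr x ∧ nr x ≤ R} :=
    ((isClosed_le continuous_const continuous_nr).inter
      (isClosed_le continuous_nr continuous_const)).measurableSet
  have : OR R = slab ∩ {x : V3 | R - 1 ≤ nr x ∧ nr x ≤ R} := rfl
  rw [this, ← setIntegral_indicator hs]
  refine integral_congr_ae (Filter.Eventually.of_forall fun x => ?_)
  by_cases hx : x ∈ {x : V3 | R - 1 ≤ nr x ∧ nr x ≤ R}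
  · beta_reduce
    rw [annulusWeight_of_mem hx, Set.indicator_of_mem hx, div_eq_inv_mul]
  · beta_reduce
    rw [annulusWeight_of_notMem hx, Set.indicator_of_notMem hx, zero_mul]

/-- The divergence theorem tested against the Lipschitz cut-off `phiR R`. -/
theorem setIntegral_slab_phiR_mul_divergence {R : ℝ} (hR : 2 < R) {G : Fin 3 → V3 → ℝ}
    (hG : ∀ i, ContDiff ℝ 1 (G i)) (hper : ∀ x, G 2 (x + Pi.single 2 1) = G 2 x) :
    ∫ x in slab, phiR R x * ∑ i, pd i (G i) x
      = ∫ x in OR R, (x 0 * G 0 x + x 1 * G 1 x) / nr x := by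
  have hA : ∀ i, IntegrableOn (fun x => phiR R x * pd i (G i) x) slab := fun i =>
    integrableOn_slab_phiR_mul R (continuous_pd (hG i) i)
  have hB : ∀ i : Fin 3, IntegrableOn (fun x => annulusWeight R x * (x i * G i x)) slab :=
    fun i => integrableOn_slab_annulusWeight_mul hR ((continuous_apply i).mul (hG i).continuous)
  have hH : ∀ i : Fin 3, i ≠ 2 → ∫ x in slab, phiR R x * pd i (G i) x
      = ∫ x in slab, annulusWeight R x * (x i * G i x) := by
    intro i hi
    rw [← sub_eq_zero, ← integral_sub (hA i) (hB i),
      ← setIntegral_slab_phiR_horizontal hR hi (hG i)]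
    congr 1
    ext x
    ring
  rw [← setIntegral_slab_annulusWeight_mul]
  simp only [Finset.mul_sum, mul_add]
  rw [integral_finsetSum _ fun i _ => hA i, Fin.sum_univ_three, hH 0 (by decide),
    hH 1 (by decide), setIntegral_slab_phiR_vertical R (hG 2) hper, add_zero,
    integral_add (hB 0) (hB 1)]

theorem pd_add {f g : V3 → ℝ} (hf : Differentiable ℝ f) (hg : Differentiable ℝ g) (i : Fin 3)
    (x : V3) : pd i (fun y => f y + g y) x = pd i f x + pd i g x := by
  simp [pd, fderiv_fun_add (hf x) (hg x)]

theorem pd_sub {f g : V3 → ℝ} (hf : Differentiable ℝ f) (hg : Differentiable ℝ g) (i : Fin 3)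
    (x : V3) : pd i (fun y => f y - g y) x = pd i f x - pd i g x := by
  simp [pd, fderiv_fun_sub (hf x) (hg x)]

theorem pd_mul {f g : V3 → ℝ} (hf : Differentiable ℝ f) (hg : Differentiable ℝ g) (i : Fin 3)
    (x : V3) : pd i (fun y => f y * g y) x = pd i f x * g x + f x * pd i g x := by
  simp [pd, fderiv_fun_mul (hf x) (hg x)]
  ring

theorem pd_const (c : ℝ) (i : Fin 3) (x : V3) : pd i (fun _ => c) x = 0 := by
  simp [pd]

theorem contDiff_pd {f : V3 → ℝ} (hf : ContDiff ℝ (⊤ : ℕ∞) f) (i : Fin 3) :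
    ContDiff ℝ (⊤ : ℕ∞) (pd i f) :=
  (hf.fderiv_right (m := (⊤ : ℕ∞)) le_rfl).clm_apply contDiff_const

theorem pd_add_right_of_periodic {f : V3 → ℝ} {v : V3} (hf : ∀ x, f (x + v) = f x) (i : Fin 3)
    (x : V3) : pd i f (x + v) = pd i f x := by
  have : (fun y => f (y + v)) = f := funext hf
  rw [pd, ← fderiv_comp_add_right, this, pd]

theorem PeriodicZ.add_single {u : V3 → V3} (hu : PeriodicZ u) (x : V3) :
    u (x + Pi.single 2 1) = u x := by
  rw [← hu x]
  congr 1
  ext j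
  fin_cases j <;> simp

theorem fderiv_eq_zero_of_pd {f : V3 → ℝ} {x : V3} (h : ∀ i, pd i f x = 0) :
    fderiv ℝ f x = 0 := by
  apply ContinuousLinearMap.coe_injective
  refine (Pi.basisFun ℝ (Fin 3)).ext fun i => ?_
  simpa [pd] using h i

/-- The flux of total energy of an MHD/Hall-MHD flow. -/
def energyFlux (δ : ℝ) (u b : V3 → V3) (p : V3 → ℝ) (i : Fin 3) (x : V3) : ℝ :=
  u x i * ((1 / 2) * (sq3 (u x) + sq3 (b x)) + p x) - b x i * dot3 (u x) (b x)
    - ∑ j, (pd i (fun y => u y j) x * u x j + pd i (fun y => b y j) x * b x j)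
    - δ * cross3 (cross3 (curl b x) (b x)) (b x) i

section

variable {δ : ℝ} {u b : V3 → V3} {p : V3 → ℝ}

theorem contDiff_hallForce (hb : ContDiff ℝ (⊤ : ℕ∞) b) (i : Fin 3) :
    ContDiff ℝ (⊤ : ℕ∞) fun x => cross3 (curl b x) (b x) i := by
  have hb' : ∀ j, ContDiff ℝ (⊤ : ℕ∞) fun x => b x j := contDiff_pi.1 hb
  have hdb : ∀ i j, ContDiff ℝ (⊤ : ℕ∞) (pd i fun x => b x j) := fun i j => contDiff_pd (hb' j) i
  fin_cases i <;> simp [cross3, curl] <;> fun_prop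

theorem contDiff_energyFlux (hu : ContDiff ℝ (⊤ : ℕ∞) u) (hb : ContDiff ℝ (⊤ : ℕ∞) b)
    (hp : ContDiff ℝ (⊤ : ℕ∞) p) (i : Fin 3) :
    ContDiff ℝ (⊤ : ℕ∞) (energyFlux δ u b p i) := by
  have hu' : ∀ j, ContDiff ℝ (⊤ : ℕ∞) fun x => u x j := contDiff_pi.1 hu
  have hb' : ∀ j, ContDiff ℝ (⊤ : ℕ∞) fun x => b x j := contDiff_pi.1 hb
  have hdu : ∀ i j, ContDiff ℝ (⊤ : ℕ∞) (pd i fun x => u x j) := fun i j => contDiff_pd (hu' j) i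
  have hdb : ∀ i j, ContDiff ℝ (⊤ : ℕ∞) (pd i fun x => b x j) := fun i j => contDiff_pd (hb' j) i
  have hF := contDiff_hallForce hb
  have hFb : ContDiff ℝ (⊤ : ℕ∞) fun x => cross3 (cross3 (curl b x) (b x)) (b x) i := by
    have key : ∀ k l, ContDiff ℝ (⊤ : ℕ∞) fun x => cross3 (curl b x) (b x) k * b x l :=
      fun k l => (hF k).mul (hb' l)
    fin_cases i
    · exact (key 1 2).sub (key 2 1)
    · exact (key 2 0).sub (key 0 2)
    · exact (key 0 1).sub (key 1 0)
  unfold energyFlux sq3 dot3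
  fun_prop

theorem divergence_energyFlux (hu : ContDiff ℝ (⊤ : ℕ∞) u) (hb : ContDiff ℝ (⊤ : ℕ∞) b)
    (hp : ContDiff ℝ (⊤ : ℕ∞) p) (hsol : IsMHD δ u b p) (x : V3) :
    ∑ i, pd i (energyFlux δ u b p i) x = -(gradSq u x + gradSq b x) := by
  have hp1 : Differentiable ℝ p := hp.differentiable (by simp)
  have hu' : ∀ j, ContDiff ℝ (⊤ : ℕ∞) fun x => u x j := contDiff_pi.1 hu
  have hb' : ∀ j, ContDiff ℝ (⊤ : ℕ∞) fun x => b x j := contDiff_pi.1 hb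
  have hu1 : ∀ j, Differentiable ℝ fun x => u x j := fun j => (hu' j).differentiable (by simp)
  have hb1 : ∀ j, Differentiable ℝ fun x => b x j := fun j => (hb' j).differentiable (by simp)
  have hdu : ∀ i j, Differentiable ℝ (pd i fun x => u x j) :=
    fun i j => (contDiff_pd (hu' j) i).differentiable (by simp)
  have hdb : ∀ i j, Differentiable ℝ (pd i fun x => b x j) :=
    fun i j => (contDiff_pd (hb' j) i).differentiable (by simp)
  obtain ⟨h1, h2, h3, h4⟩ := hsol
  have hFJ : dot3 (cross3 (curl b x) (b x)) (curl b x) = 0 := by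
    simp [dot3, cross3, Fin.sum_univ_three]; ring
  have hF1 : ∀ k, Differentiable ℝ fun x => cross3 (curl b x) (b x) k :=
    fun k => (contDiff_hallForce hb k).differentiable (by simp)
  unfold energyFlux
  generalize hF : (fun y => cross3 (curl b y) (b y)) = F at h2 hF1
  have hFx : ∀ y, cross3 (curl b y) (b y) = F y := fun y => congrFun hF y
  simp only [hFx] at hF1 hFJ ⊢
  have e10 := h1 x 0
  have e11 := h1 x 1
  have e12 := h1 x 2
  have e20 := h2 x 0
  have e21 := h2 x 1
  have e22 := h2 x 2
  have e3 := h3 x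
  have e4 := h4 x
  simp only [Fin.sum_univ_three, lap, curl, dot3, gradSq, sq3, cross3, pow_two, Matrix.cons_val_zero,
    Matrix.cons_val_one, Matrix.cons_val] at e10 e11 e12 e20 e21 e22 e3 e4 hFJ ⊢
  simp (disch := fun_prop) only [pd_add, pd_sub, pd_mul, pd_const]
  linear_combination u x 0 * e10 + u x 1 * e11 + u x 2 * e12 + b x 0 * e20 + b x 1 * e21
    + b x 2 * e22 + e3 * ((1 / 2) * (u x 0 * u x 0 + u x 1 * u x 1 + u x 2 * u x 2
      + (b x 0 * b x 0 + b x 1 * b x 1 + b x 2 * b x 2)) + p x)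
    - e4 * (u x 0 * b x 0 + u x 1 * b x 1 + u x 2 * b x 2) + δ * hFJ

theorem energyFlux_periodic (hup : PeriodicZ u) (hbp : PeriodicZ b)
    (hpp : ∀ x, p (x + Pi.single 2 1) = p x) (i : Fin 3) (x : V3) :
    energyFlux δ u b p i (x + Pi.single 2 1) = energyFlux δ u b p i x := by
  have hu : ∀ j k, pd k (fun y => u y j) (x + Pi.single 2 1) = pd k (fun y => u y j) x :=
    fun j k => pd_add_right_of_periodic (fun y => congrFun (hup.add_single y) j) k x
  have hb : ∀ j k, pd k (fun y => b y j) (x + Pi.single 2 1) = pd k (fun y => b y j) x :=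
    fun j k => pd_add_right_of_periodic (fun y => congrFun (hbp.add_single y) j) k x
  simp only [energyFlux, curl, hu, hb, hup.add_single, hbp.add_single, hpp]

end

theorem exists_smooth_cutoff : ∃ A : ℝ, 0 ≤ A ∧ ∀ ρ : ℝ, 1 ≤ ρ → ∃ h : ℝ → ℝ,
    ContDiff ℝ (⊤ : ℕ∞) h ∧ (∀ t, 0 ≤ h t) ∧ (∀ t, h t ≤ 1) ∧ (∀ t, |t| ≤ ρ → h t = 1) ∧
    (∀ t, 2 * ρ < |t| → h t = 0 ∧ deriv h t = 0 ∧ deriv (deriv h) t = 0) ∧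
    (∀ t, |deriv h t| ≤ A / ρ) ∧ ∀ t, |deriv (deriv h) t| ≤ A / ρ := by
  let f : ContDiffBump (0 : ℝ) := ⟨1, 2, one_pos, one_lt_two⟩
  have hf : ContDiff ℝ (⊤ : ℕ∞) f := f.contDiff
  have hf1 : ContDiff ℝ (⊤ : ℕ∞) (deriv f) := (contDiff_infty_iff_deriv.1 hf).2
  have hf2 : ContDiff ℝ (⊤ : ℕ∞) (deriv (deriv f)) := (contDiff_infty_iff_deriv.1 hf1).2
  obtain ⟨A₁, hA₁⟩ := f.hasCompactSupport.deriv.exists_bound_of_continuous hf1.continuous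
  obtain ⟨A₂, hA₂⟩ := f.hasCompactSupport.deriv.deriv.exists_bound_of_continuous hf2.continuous
  refine ⟨max A₁ A₂, le_max_of_le_left ((norm_nonneg _).trans (hA₁ 0)), fun ρ hρ => ?_⟩
  have hρ0 : 0 < ρ := one_pos.trans_le hρ
  have hd1 : deriv (fun t => f (ρ⁻¹ * t)) = fun t => ρ⁻¹ * deriv f (ρ⁻¹ * t) := by
    ext t
    simpa using deriv_comp_mul_left ρ⁻¹ f t
  have hd2 : deriv (deriv fun t => f (ρ⁻¹ * t)) =
      fun t => ρ⁻¹ * (ρ⁻¹ * deriv (deriv f) (ρ⁻¹ * t)) := by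
    rw [hd1]
    ext t
    rw [deriv_const_mul_field]
    congr 1
    simpa using deriv_comp_mul_left ρ⁻¹ (deriv f) t
  refine ⟨fun t => f (ρ⁻¹ * t), hf.comp (contDiff_const.mul contDiff_id), fun t => f.nonneg,
    fun t => f.le_one, fun t ht => f.one_of_mem_closedBall ?_, fun t ht => ?_, fun t => ?_,
    fun t => ?_⟩
  · rw [mem_closedBall_zero_iff, Real.norm_eq_abs, abs_mul, abs_of_pos (inv_pos.2 hρ0)]
    exact (inv_mul_le_one₀ hρ0).2 ht
  · have hnot : ρ⁻¹ * t ∉ tsupport f := by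
      rw [f.tsupport_eq, mem_closedBall_zero_iff, Real.norm_eq_abs, abs_mul,
        abs_of_pos (inv_pos.2 hρ0), not_le]
      change 2 < ρ⁻¹ * |t|
      rw [lt_inv_mul_iff₀ hρ0]
      linarith
    have h1 : tsupport (deriv f) ⊆ tsupport f := tsupport_deriv_subset
    have h2 : tsupport (deriv (deriv f)) ⊆ tsupport f := tsupport_deriv_subset.trans h1
    rw [hd2, hd1]
    simp [image_eq_zero_of_notMem_tsupport hnot,
      image_eq_zero_of_notMem_tsupport (mt (@h1 _) hnot),
      image_eq_zero_of_notMem_tsupport (mt (@h2 _) hnot)]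
  · rw [hd1, abs_mul, abs_of_pos (inv_pos.2 hρ0), div_eq_inv_mul]
    exact mul_le_mul_of_nonneg_left ((hA₁ _).trans (le_max_left _ _)) (inv_pos.2 hρ0).le
  · rw [hd2, abs_mul, abs_mul, abs_of_pos (inv_pos.2 hρ0), div_eq_inv_mul]
    refine mul_le_mul_of_nonneg_left ?_ (inv_pos.2 hρ0).le
    calc ρ⁻¹ * |deriv (deriv f) (ρ⁻¹ * t)| ≤ 1 * |deriv (deriv f) (ρ⁻¹ * t)| :=
          mul_le_mul_of_nonneg_right (inv_le_one_of_one_le₀ hρ) (abs_nonneg _)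
      _ ≤ max A₁ A₂ := by
          rw [one_mul]
          exact (hA₂ _).trans (le_max_right _ _)

theorem pd_comp_apply {h : ℝ → ℝ} (hh : Differentiable ℝ h) (i j : Fin 3) (x : V3) :
    pd i (fun y => h (y j)) x = if j = i then deriv h (x j) else 0 := by
  have := (hh (x j)).hasDerivAt.comp_hasFDerivAt x (hasFDerivAt_apply (𝕜 := ℝ) j x)
  have h2 : HasFDerivAt (fun y : V3 => h (y j)) _ x := this
  rw [pd, h2.fderiv]
  simp [Pi.single_apply]

/-- The box `[-ρ, ρ]² × [0, 1]`. -/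
def slabBox (ρ : ℝ) : Set V3 := Set.Icc ![-ρ, -ρ, 0] ![ρ, ρ, 1]

theorem mem_slabBox {ρ : ℝ} {x : V3} :
    x ∈ slabBox ρ ↔ |x 0| ≤ ρ ∧ |x 1| ≤ ρ ∧ x ∈ slab := by
  simp only [slabBox, Set.mem_Icc, Pi.le_def, Fin.forall_fin_succ, abs_le, slab, Set.mem_ofPred_eq]
  simp
  tauto

theorem volume_slabBox {ρ : ℝ} (hρ : 0 ≤ ρ) : volume.real (slabBox ρ) = 4 * ρ ^ 2 := by
  rw [slabBox, measureReal_def, Real.volume_Icc_pi_toReal]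
  · simp [Fin.prod_univ_three]
    ring
  · intro i
    fin_cases i <;> simp <;> linarith

theorem nr_le_add (x : V3) : nr x ≤ |x 0| + |x 1| := by
  refine Real.sqrt_le_iff.2 ⟨by positivity, ?_⟩
  rw [← sq_abs (x 0), ← sq_abs (x 1)]
  nlinarith [abs_nonneg (x 0), abs_nonneg (x 1)]

section

variable {δ : ℝ} {u b : V3 → V3} {p : V3 → ℝ}

theorem IsMHD.pd_pressure_periodic (hup : PeriodicZ u) (hbp : PeriodicZ b)
    (hsol : IsMHD δ u b p) (i : Fin 3) (x : V3) :
    pd i p (x + Pi.single 2 1) = pd i p x := by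
  have hu : ∀ j y, u (y + Pi.single 2 1) j = u y j := fun j y => congrFun (hup.add_single y) j
  have hb : ∀ j y, b (y + Pi.single 2 1) j = b y j := fun j y => congrFun (hbp.add_single y) j
  have hdu : ∀ j k y, pd k (fun y => u y j) (y + Pi.single 2 1) = pd k (fun y => u y j) y :=
    fun j k y => pd_add_right_of_periodic (hu j) k y
  have hdb : ∀ j k y, pd k (fun y => b y j) (y + Pi.single 2 1) = pd k (fun y => b y j) y :=
    fun j k y => pd_add_right_of_periodic (hb j) k y
  have hl : lap (fun y => u y i) (x + Pi.single 2 1) = lap (fun y => u y i) x :=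
    Finset.sum_congr rfl fun k _ => pd_add_right_of_periodic (hdu i k) k x
  have h1 := hsol.1 x i
  have h2 := hsol.1 (x + Pi.single 2 1) i
  simp only [hu, hb, hdu, hdb, hl] at h2
  linarith

theorem IsMHD.exists_pressure_drift (hp : ContDiff ℝ (⊤ : ℕ∞) p) (hup : PeriodicZ u)
    (hbp : PeriodicZ b) (hsol : IsMHD δ u b p) :
    ∃ c, ∀ x, p (x + Pi.single 2 1) = p x + c := by
  have hp1 : Differentiable ℝ p := hp.differentiable (by simp)
  have hp2 : Differentiable ℝ fun x : V3 => p (x + Pi.single 2 1) :=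
    hp1.comp (differentiable_fun_id.add_const _)
  have hconst := is_const_of_fderiv_eq_zero (𝕜 := ℝ)
    (f := fun x : V3 => p (x + Pi.single 2 1) - p x) (hp2.sub hp1) fun x =>
      fderiv_eq_zero_of_pd fun i => by
        rw [pd_sub hp2 hp1, sub_eq_zero, ← hsol.pd_pressure_periodic hup hbp, pd, pd,
          fderiv_comp_add_right]
  exact ⟨_, fun x => by rw [← sub_eq_iff_eq_add']; exact hconst x 0⟩

/-- Testing the vertical momentum equation with a smooth horizontal cut-off at scale `ρ`. -/
theorem IsMHD.integral_mul_eq_of_pressure_drift (hu : ContDiff ℝ (⊤ : ℕ∞) u)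
    (hb : ContDiff ℝ (⊤ : ℕ∞) b) (hp : ContDiff ℝ (⊤ : ℕ∞) p) (hup : PeriodicZ u)
    (hbp : PeriodicZ b) (hsol : IsMHD δ u b p) {c : ℝ}
    (hc : ∀ x, p (x + Pi.single 2 1) = p x + c) {ρ : ℝ} (hρ : 1 ≤ ρ) {h : ℝ → ℝ}
    (hh : ContDiff ℝ (⊤ : ℕ∞) h)
    (h0 : ∀ t, 2 * ρ < |t| → h t = 0 ∧ deriv h t = 0 ∧ deriv (deriv h) t = 0) :
    c * ∫ x in slabBox (2 * ρ), h (x 0) * h (x 1) =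
      ∫ x in slabBox (2 * ρ), (deriv h (x 0) * h (x 1) * (u x 0 * u x 2 - b x 0 * b x 2)
        + h (x 0) * deriv h (x 1) * (u x 1 * u x 2 - b x 1 * b x 2)
        + (deriv (deriv h) (x 0) * h (x 1) + h (x 0) * deriv (deriv h) (x 1)) * u x 2) := by
  have hh1 : ContDiff ℝ (⊤ : ℕ∞) (deriv h) := (contDiff_infty_iff_deriv.1 hh).2
  have hh2 : ContDiff ℝ (⊤ : ℕ∞) (deriv (deriv h)) := (contDiff_infty_iff_deriv.1 hh1).2
  have hhd : Differentiable ℝ h := hh.differentiable (by simp)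
  have hhd1 : Differentiable ℝ (deriv h) := hh1.differentiable (by simp)
  have hh' : ∀ j : Fin 3, ContDiff ℝ (⊤ : ℕ∞) fun x : V3 => h (x j) :=
    fun j => hh.comp (contDiff_apply ℝ ℝ j)
  have hh1' : ∀ j : Fin 3, ContDiff ℝ (⊤ : ℕ∞) fun x : V3 => deriv h (x j) :=
    fun j => hh1.comp (contDiff_apply ℝ ℝ j)
  have hx' : ∀ j : Fin 3, ContDiff ℝ (⊤ : ℕ∞) fun x : V3 => x j := contDiff_apply ℝ ℝ
  have hu' : ∀ j, ContDiff ℝ (⊤ : ℕ∞) fun x => u x j := contDiff_pi.1 hu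
  have hb' : ∀ j, ContDiff ℝ (⊤ : ℕ∞) fun x => b x j := contDiff_pi.1 hb
  have hdu : ∀ i j, ContDiff ℝ (⊤ : ℕ∞) (pd i fun x => u x j) := fun i j => contDiff_pd (hu' j) i
  have dp : Differentiable ℝ p := hp.differentiable (by simp)
  have dh : ∀ j : Fin 3, Differentiable ℝ fun x : V3 => h (x j) :=
    fun j => (hh' j).differentiable (by simp)
  have dh1 : ∀ j : Fin 3, Differentiable ℝ fun x : V3 => deriv h (x j) :=
    fun j => (hh1' j).differentiable (by simp)
  have dx : ∀ j : Fin 3, Differentiable ℝ fun x : V3 => x j :=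
    fun j => (hx' j).differentiable (by simp)
  have du : ∀ j, Differentiable ℝ fun x => u x j := fun j => (hu' j).differentiable (by simp)
  have db : ∀ j, Differentiable ℝ fun x => b x j := fun j => (hb' j).differentiable (by simp)
  have ddu : ∀ i j, Differentiable ℝ (pd i fun x => u x j) :=
    fun i j => (hdu i j).differentiable (by simp)
  let G : Fin 3 → V3 → ℝ := ![
    fun x => h (x 0) * h (x 1) * (u x 0 * u x 2 - b x 0 * b x 2 - pd 0 (fun y => u y 2) x)
      + deriv h (x 0) * h (x 1) * u x 2,
    fun x => h (x 0) * h (x 1) * (u x 1 * u x 2 - b x 1 * b x 2 - pd 1 (fun y => u y 2) x)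
      + h (x 0) * deriv h (x 1) * u x 2,
    fun x => h (x 0) * h (x 1) * (u x 2 * u x 2 - b x 2 * b x 2 - pd 2 (fun y => u y 2) x
      + (p x - c * x 2))]
  have hG : ∀ i, ContDiff ℝ (⊤ : ℕ∞) (G i) := by
    intro i
    fin_cases i <;> simp [G] <;> fun_prop
  have hper : ∀ x, G 2 (x + Pi.single 2 1) = G 2 x := by
    intro x
    have hd : pd 2 (fun y => u y 2) (x + Pi.single 2 1) = pd 2 (fun y => u y 2) x :=
      pd_add_right_of_periodic (fun y => congrFun (hup.add_single y) 2) 2 x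
    simp only [G, Matrix.cons_val, hd, hup.add_single, hbp.add_single, hc]
    simp
    left
    ring
  have hdiv : ∀ x, ∑ i, pd i (G i) x =
      (deriv h (x 0) * h (x 1) * (u x 0 * u x 2 - b x 0 * b x 2)
        + h (x 0) * deriv h (x 1) * (u x 1 * u x 2 - b x 1 * b x 2)
        + (deriv (deriv h) (x 0) * h (x 1) + h (x 0) * deriv (deriv h) (x 1)) * u x 2)
      - c * (h (x 0) * h (x 1)) := by
    intro x
    obtain ⟨h1, -, h3, h4⟩ := hsol
    have e1 := h1 x 2
    have e3 := h3 x
    have e4 := h4 x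
    have ph : ∀ i j : Fin 3, pd i (fun y => h (y j)) x = if j = i then deriv h (x j) else 0 :=
      fun i j => pd_comp_apply hhd i j x
    have ph1 : ∀ i j : Fin 3, pd i (fun y => deriv h (y j)) x
        = if j = i then deriv (deriv h) (x j) else 0 := fun i j => pd_comp_apply hhd1 i j x
    have px : pd 2 (fun y => y 2) x = 1 := by
      simpa using pd_comp_apply (h := id) differentiable_id 2 2 x
    simp only [Fin.sum_univ_three, lap] at e1 e3 e4
    simp only [Fin.sum_univ_three, G, Matrix.cons_val_zero, Matrix.cons_val_one, Matrix.cons_val]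
    simp (disch := fun_prop) only [pd_add, pd_sub, pd_mul, pd_const, ph, ph1, px]
    simp only [reduceIte, Fin.reduceEq, Fin.isValue]
    linear_combination h (x 0) * h (x 1) * (e1 + u x 2 * e3 - b x 2 * e4)
  have hout : ∀ x, 2 * ρ < |x 0| ∨ 2 * ρ < |x 1| → G 0 x = 0 ∧ G 1 x = 0 ∧
      ∑ i, pd i (G i) x = 0 := by
    rintro x (hx | hx) <;> obtain ⟨a1, a2, a3⟩ := h0 _ hx <;> rw [hdiv] <;> simp [G, a1, a2, a3]
  have key := setIntegral_slab_phiR_mul_divergence (R := 4 * ρ + 2) (by linarith)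
    (fun i => (hG i).of_le (by simp)) hper
  have hzero : ∫ x in OR (4 * ρ + 2), (x 0 * G 0 x + x 1 * G 1 x) / nr x = 0 := by
    refine setIntegral_eq_zero_of_forall_eq_zero fun x hx => ?_
    have hx := hx.2.1
    have : 2 * ρ < |x 0| ∨ 2 * ρ < |x 1| := by
      by_contra! hcon
      linarith [nr_le_add x]
    obtain ⟨a, b, -⟩ := hout x this
    simp [a, b]
  have hcompact : IsCompact (slabBox (2 * ρ)) := isCompact_Icc
  have hcont : ∀ {f : V3 → ℝ}, Continuous f → IntegrableOn f (slabBox (2 * ρ)) :=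
    fun hf => hf.continuousOn.integrableOn_compact hcompact
  have hbox : ∫ x in slab, phiR (4 * ρ + 2) x * ∑ i, pd i (G i) x
      = ∫ x in slabBox (2 * ρ), ∑ i, pd i (G i) x := by
    rw [setIntegral_eq_of_subset_of_forall_sdiff_eq_zero measurableSet_slab
      (fun x hx => (mem_slabBox.1 hx).2.2)]
    · refine setIntegral_congr_fun measurableSet_Icc fun x hx => ?_
      obtain ⟨a, b, -⟩ := mem_slabBox.1 hx
      rw [phiR_of_nr_le (by linarith [nr_le_add x]), one_mul]
    · rintro x ⟨hx, hx'⟩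
      have : 2 * ρ < |x 0| ∨ 2 * ρ < |x 1| := by
        by_contra! hcon
        exact hx' (mem_slabBox.2 ⟨hcon.1, hcon.2, hx⟩)
      rw [(hout x this).2.2, mul_zero]
  rw [hbox, hzero] at key
  simp only [hdiv] at key
  have ch := hh.continuous
  have ch1 := hh1.continuous
  have ch2 := hh2.continuous
  have cu := hu.continuous
  have cb := hb.continuous
  rw [integral_sub (hcont (by fun_prop)) (hcont (by fun_prop)), integral_const_mul] at key
  linarith

theorem IsMHD.pressure_periodic (hu : ContDiff ℝ (⊤ : ℕ∞) u)
    (hb : ContDiff ℝ (⊤ : ℕ∞) b) (hp : ContDiff ℝ (⊤ : ℕ∞) p) (hubd : Bounded3 u)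
    (hbbd : Bounded3 b) (hup : PeriodicZ u) (hbp : PeriodicZ b) (hsol : IsMHD δ u b p) (x : V3) :
    p (x + Pi.single 2 1) = p x := by
  obtain ⟨c, hc⟩ := hsol.exists_pressure_drift hp hup hbp
  obtain ⟨M₁, hM₁⟩ := hubd
  obtain ⟨M₂, hM₂⟩ := hbbd
  obtain ⟨A, hA, hcut⟩ := exists_smooth_cutoff
  set M := max M₁ M₂
  have hu1 : ∀ x j, |u x j| ≤ M := fun x j =>
    (norm_le_pi_norm (u x) j).trans ((hM₁ x).trans (le_max_left _ _))
  have hb1 : ∀ x j, |b x j| ≤ M := fun x j =>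
    (norm_le_pi_norm (b x) j).trans ((hM₂ x).trans (le_max_right _ _))
  have hM : 0 ≤ M := (abs_nonneg _).trans (hu1 0 0)
  have hbound : ∀ ρ : ℝ, 1 ≤ ρ → |c| * ρ ≤ 4 * (A * (4 * M ^ 2 + 2 * M)) := by
    intro ρ hρ
    obtain ⟨h, hh, hnn, hle, hone, h0, hd1, hd2⟩ := hcut ρ hρ
    have hρ0 : 0 < ρ := by linarith
    have key := hsol.integral_mul_eq_of_pressure_drift hu hb hp hup hbp hc hρ hh h0
    have hlow : 4 * ρ ^ 2 ≤ ∫ x in slabBox (2 * ρ), h (x 0) * h (x 1) := by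
      rw [← volume_slabBox hρ0.le]
      have hint : IntegrableOn (fun x : V3 => h (x 0) * h (x 1)) (slabBox (2 * ρ)) := by
        have := hh.continuous
        exact ContinuousOn.integrableOn_compact isCompact_Icc (by fun_prop)
      calc volume.real (slabBox ρ) = ∫ x in slabBox ρ, (1 : ℝ) := by simp
        _ = ∫ x in slabBox ρ, h (x 0) * h (x 1) := by
          refine setIntegral_congr_fun measurableSet_Icc fun x hx => ?_
          obtain ⟨h1, h2, -⟩ := mem_slabBox.1 hx
          rw [hone _ h1, hone _ h2, one_mul]
        _ ≤ _ := by
          refine setIntegral_mono_set hint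
            (Filter.Eventually.of_forall fun x => mul_nonneg (hnn _) (hnn _))
            (LE.le.eventuallyLE fun x hx => ?_)
          obtain ⟨h1, h2, h3⟩ := mem_slabBox.1 hx
          exact mem_slabBox.2 ⟨by linarith, by linarith, h3⟩
    have habs : ∀ t, |h t| ≤ 1 := fun t => abs_le.2 ⟨by linarith [hnn t], hle t⟩
    have hup' := norm_setIntegral_le_of_norm_le_const (μ := volume) (s := slabBox (2 * ρ))
      (C := A / ρ * (4 * M ^ 2 + 2 * M))
      (f := fun x => deriv h (x 0) * h (x 1) * (u x 0 * u x 2 - b x 0 * b x 2)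
        + h (x 0) * deriv h (x 1) * (u x 1 * u x 2 - b x 1 * b x 2)
        + (deriv (deriv h) (x 0) * h (x 1) + h (x 0) * deriv (deriv h) (x 1)) * u x 2)
      isCompact_Icc.measure_lt_top fun x _ => by
        have hprod : ∀ {a b A B : ℝ}, |a| ≤ A → |b| ≤ B → |a * b| ≤ A * B := fun ha hb => by
          rw [abs_mul]
          exact mul_le_mul ha hb (abs_nonneg _) ((abs_nonneg _).trans ha)
        have hadd : ∀ {a b A B : ℝ}, |a| ≤ A → |b| ≤ B → |a + b| ≤ A + B := fun ha hb =>
          (abs_add_le _ _).trans (add_le_add ha hb)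
        have hsub : ∀ {a b A B : ℝ}, |a| ≤ A → |b| ≤ B → |a - b| ≤ A + B := fun ha hb =>
          (abs_sub _ _).trans (add_le_add ha hb)
        have e1 := hprod (hprod (hd1 (x 0)) (habs (x 1)))
          (hsub (hprod (hu1 x 0) (hu1 x 2)) (hprod (hb1 x 0) (hb1 x 2)))
        have e2 := hprod (hprod (habs (x 0)) (hd1 (x 1)))
          (hsub (hprod (hu1 x 1) (hu1 x 2)) (hprod (hb1 x 1) (hb1 x 2)))
        have e3 := hprod (hadd (hprod (hd2 (x 0)) (habs (x 1)))
          (hprod (habs (x 0)) (hd2 (x 1)))) (hu1 x 2)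
        refine (hadd (hadd e1 e2) e3).trans (le_of_eq ?_)
        ring
    rw [← key, Real.norm_eq_abs, abs_mul, volume_slabBox (by linarith)] at hup'
    have h1 : |c| * (4 * ρ ^ 2) ≤ A / ρ * (4 * M ^ 2 + 2 * M) * (4 * (2 * ρ) ^ 2) :=
      (mul_le_mul_of_nonneg_left (hlow.trans (le_abs_self _)) (abs_nonneg c)).trans hup'
    have h2 : A / ρ * (4 * M ^ 2 + 2 * M) * (4 * (2 * ρ) ^ 2)
        = 4 * (A * (4 * M ^ 2 + 2 * M)) * (4 * ρ) := by
      field_simp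
      ring
    rw [h2] at h1
    refine le_of_mul_le_mul_right ?_ (show 0 < 4 * ρ by linarith)
    linarith
  have hc0 : c = 0 := by
    by_contra hne
    have hpos : 0 < |c| := abs_pos.2 hne
    have := hbound (4 * (A * (4 * M ^ 2 + 2 * M)) / |c| + 1)
      (le_add_of_nonneg_left (by positivity))
    rw [mul_add, mul_div_cancel₀ _ hpos.ne'] at this
    linarith
  rw [hc, hc0, add_zero]

end

theorem integrableOn_OR_div {R : ℝ} (hR : 2 < R) {f : V3 → ℝ} (hf : Continuous f) :
    IntegrableOn (fun x => f x / nr x) (OR R) := by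
  have hclosed : IsClosed (OR R) :=
    ((isClosed_le continuous_const (continuous_apply 2)).inter
      (isClosed_le (continuous_apply 2) continuous_const)).inter
      ((isClosed_le continuous_const continuous_nr).inter
        (isClosed_le continuous_nr continuous_const))
  have hcompact : IsCompact (OR R) :=
    (isCompact_cylSet R).of_isClosed_subset hclosed fun x hx => ⟨hx.1, hx.2.2⟩
  refine (hf.continuousOn.div continuous_nr.continuousOn fun x hx => ?_).integrableOn_compact
    hcompact
  linarith [hx.2.1]

theorem setIntegral_OR_ur_eq_zero {R : ℝ} (hR : 2 < R) {u : V3 → V3}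
    (hu : ContDiff ℝ (⊤ : ℕ∞) u) (hup : PeriodicZ u) (hdiv : DivFree u) :
    ∫ x in OR R, ur u x = 0 := by
  have h := setIntegral_slab_phiR_mul_divergence hR (G := fun i x => u x i)
    (fun i => (contDiff_pi.1 hu i).of_le (by simp)) fun x => congrFun (hup.add_single x) 2
  simp only [hdiv _, mul_zero, integral_zero] at h
  exact h.symm

/-- The basic energy identity obtained by testing the system with
`(φ_R u, φ_R b)`. -/
theorem energy_identity (δ : ℝ) (hδ : δ ∈ Set.Icc (0:ℝ) 1)
    (u b : V3 → V3) (p : V3 → ℝ)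
    (hu : ContDiff ℝ (⊤ : ℕ∞) u) (hb : ContDiff ℝ (⊤ : ℕ∞) b) (hp : ContDiff ℝ (⊤ : ℕ∞) p)
    (hubd : Bounded3 u) (hbbd : Bounded3 b)
    (hup : PeriodicZ u) (hbp : PeriodicZ b)
    (hsol : IsMHD δ u b p) :
    ∀ R > (2:ℝ),
      (∫ x in slab, (gradSq u x + gradSq b x) * phiR R x)
        = (∫ x in OR R,
            ((∑ j, radD (fun y => u y j) x * u x j) +
             (∑ j, radD (fun y => b y j) x * b x j)))
          - (1 / 2) * (∫ x in OR R, (sq3 (u x) + sq3 (b x)) * ur u x)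
          - (∫ x in OR R,
              (p x - (volume (OR R)).toReal⁻¹ * ∫ y in OR R, p y) * ur u x)
          + (∫ x in OR R, dot3 (u x) (b x) * ur b x)
          - δ * ∫ x in OR R,
              dot3 (cross3 (curl b x) (b x)) (cross3 (er3 x) (b x)) := by
  intro R hR
  have hpp := hsol.pressure_periodic hu hb hp hubd hbbd hup hbp
  have key := setIntegral_slab_phiR_mul_divergence hR (G := energyFlux δ u b p)
    (fun i => (contDiff_energyFlux hu hb hp i).of_le (by simp))
    (energyFlux_periodic hup hbp hpp 2)
  simp only [divergence_energyFlux hu hb hp hsol, mul_neg, integral_neg] at key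
  have cu : ∀ j, Continuous fun x => u x j := fun j => (contDiff_pi.1 hu j).continuous
  have cb : ∀ j, Continuous fun x => b x j := fun j => (contDiff_pi.1 hb j).continuous
  have cp := hp.continuous
  have cdu : ∀ i j, Continuous (pd i fun x => u x j) :=
    fun i j => (contDiff_pd (contDiff_pi.1 hu j) i).continuous
  have cdb : ∀ i j, Continuous (pd i fun x => b x j) :=
    fun i j => (contDiff_pd (contDiff_pi.1 hb j) i).continuous
  have i1 : IntegrableOn (fun x => (∑ j, radD (fun y => u y j) x * u x j) +
      ∑ j, radD (fun y => b y j) x * b x j) (OR R) := by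
    convert integrableOn_OR_div hR (f := fun x =>
      ∑ j, ((x 0 * pd 0 (fun y => u y j) x + x 1 * pd 1 (fun y => u y j) x) * u x j
        + (x 0 * pd 0 (fun y => b y j) x + x 1 * pd 1 (fun y => b y j) x) * b x j))
      (by fun_prop) using 2 with x
    simp only [radD, Fin.sum_univ_three]
    ring
  have i2 : IntegrableOn (fun x => (sq3 (u x) + sq3 (b x)) * ur u x) (OR R) := by
    convert integrableOn_OR_div hR (f := fun x =>
      (sq3 (u x) + sq3 (b x)) * (x 0 * u x 0 + x 1 * u x 1))
      (by unfold sq3; fun_prop) using 2 with x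
    simp only [ur]
    ring
  have i3 : IntegrableOn (fun x => p x * ur u x) (OR R) := by
    convert integrableOn_OR_div hR (f := fun x => p x * (x 0 * u x 0 + x 1 * u x 1))
      (by fun_prop) using 2 with x
    simp only [ur]
    ring
  have i3' : IntegrableOn (ur u) (OR R) :=
    integrableOn_OR_div hR (f := fun x => x 0 * u x 0 + x 1 * u x 1) (by fun_prop)
  have i4 : IntegrableOn (fun x => dot3 (u x) (b x) * ur b x) (OR R) := by
    convert integrableOn_OR_div hR (f := fun x =>
      dot3 (u x) (b x) * (x 0 * b x 0 + x 1 * b x 1))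
      (by unfold dot3; fun_prop) using 2 with x
    simp only [ur]
    ring
  have i5 : IntegrableOn (fun x => dot3 (cross3 (curl b x) (b x)) (cross3 (er3 x) (b x)))
      (OR R) := by
    have cF := fun k => (contDiff_hallForce hb k).continuous
    convert integrableOn_OR_div hR (f := fun x =>
      cross3 (curl b x) (b x) 0 * (x 1 * b x 2) - cross3 (curl b x) (b x) 1 * (x 0 * b x 2)
        + cross3 (curl b x) (b x) 2 * (x 0 * b x 1 - x 1 * b x 0))
      (by fun_prop) using 2 with x
    generalize cross3 (curl b x) (b x) = F
    simp [dot3, cross3, er3, Fin.sum_univ_three]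
    ring
  have hflux : ∀ x, (x 0 * energyFlux δ u b p 0 x + x 1 * energyFlux δ u b p 1 x) / nr x
      = (1 / 2) * ((sq3 (u x) + sq3 (b x)) * ur u x) + p x * ur u x
        - dot3 (u x) (b x) * ur b x
        - ((∑ j, radD (fun y => u y j) x * u x j) + ∑ j, radD (fun y => b y j) x * b x j)
        + δ * dot3 (cross3 (curl b x) (b x)) (cross3 (er3 x) (b x)) := by
    intro x
    simp only [energyFlux]
    generalize cross3 (curl b x) (b x) = F
    simp [dot3, cross3, er3, ur, radD, Fin.sum_univ_three]
    ring
  simp only [hflux] at key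
  have i2c := i2.const_mul (1 / 2)
  have i5c := i5.const_mul δ
  rw [integral_add (by exact ((i2c.add i3).sub i4).sub i1) (by exact i5c),
    integral_sub (by exact (i2c.add i3).sub i4) (by exact i1),
    integral_sub (by exact i2c.add i3) (by exact i4), integral_add i2c i3,
    integral_const_mul, integral_const_mul] at key
  have hmean : ∫ x in OR R, (p x - (volume (OR R)).toReal⁻¹ * ∫ y in OR R, p y) * ur u x
      = ∫ x in OR R, p x * ur u x := by
    simp only [sub_mul]
    rw [integral_sub i3 (i3'.const_mul _), integral_const_mul,
      setIntegral_OR_ur_eq_zero hR hu hup hsol.2.2.1, mul_zero, sub_zero]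
  rw [hmean]
  simp only [mul_comm (phiR R _)] at key
  linarith
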